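/- arXiv:1805.03825 — 5 statements merged into one kernel-verified Lean document; each statement's English description precedes it below -/
import Mathlib

section
/- Let ξ be a random variable with law N(0,1). For every bounded Borel measurable map b : ℝ → ℝ, all x₁, x₂ ∈ (0,∞), and every x ∈ ℝ, the one-step normal transform satisfies 𝒩_{b,μ,σ}(x₁, x₂, x) = E[ b( (x₁/(x₁+x₂))·x + σ·√(x₁x₂/(x₁+x₂))·ξ ) ]. -/
open MeasureTheory ProbabilityTheory Real

/-- The standard normal density. -/
noncomputable def stdNormalPDF (x : ℝ) : ℝ := Real.exp (-x ^ 2 / 2) / Real.sqrt (2 * Real.pi)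

/-- The normal transform `𝒩_{(b₁,…,b_i),μ,σ}(x₁,…,x_{i+1},x)` of a tuple of
bounded Borel measurable maps. -/
noncomputable def normalTransform (μ σ : ℝ) {i : ℕ} (b : Fin i → ℝ → ℝ)
    (xs : Fin (i + 1) → ℝ) (x : ℝ) : ℝ :=
  (∫ z : Fin i → ℝ,
      (∏ j : Fin i,
        (stdNormalPDF ((z j - μ * xs j.castSucc) / (σ * Real.sqrt (xs j.castSucc))) /
            (σ * Real.sqrt (xs j.castSucc))) *
          b j (∑ k ∈ Finset.Iic j, z k)) *
        (stdNormalPDF ((x - (∑ k, z k) - μ * xs (Fin.last i)) /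
            (σ * Real.sqrt (xs (Fin.last i)))) /
          (σ * Real.sqrt (xs (Fin.last i))))) /
    ((1 / (σ * Real.sqrt (∑ k, xs k))) *
      stdNormalPDF ((x - μ * ∑ k, xs k) / (σ * Real.sqrt (∑ k, xs k))))

open scoped NNReal

/-- The rescaled standard normal density is the density of the corresponding Gaussian law. -/
lemma stdNormalPDF_div_eq_gaussianPDFReal {s : ℝ} (hs : 0 < s) {v : ℝ≥0} (hv : (v : ℝ) = s ^ 2)
    (m y : ℝ) : stdNormalPDF ((y - m) / s) / s = gaussianPDFReal m v y := by
  have hsqrt : √(2 * π * s ^ 2) = √(2 * π) * s := by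
    rw [Real.sqrt_mul (by positivity), Real.sqrt_sq hs.le]
  rw [stdNormalPDF, gaussianPDFReal, hv, hsqrt]
  have hexp : -((y - m) / s) ^ 2 / 2 = -(y - m) ^ 2 / (2 * s ^ 2) := by field_simp
  rw [hexp]
  field_simp

/-- Disintegration of a product of Gaussian densities along the sum of the two variables. -/
lemma gaussianPDFReal_mul_gaussianPDFReal_sub {v w : ℝ≥0} (hv : v ≠ 0) (hw : w ≠ 0)
    (p q x z : ℝ) :
    gaussianPDFReal p v z * gaussianPDFReal q w (x - z) =
      gaussianPDFReal (p + q) (v + w) x *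
        gaussianPDFReal (p + v / (v + w) * (x - p - q)) (v * w / (v + w)) z := by
  have hv' : 0 < (v : ℝ) := by positivity
  have hw' : 0 < (w : ℝ) := by positivity
  simp only [gaussianPDFReal, NNReal.coe_add, NNReal.coe_mul, NNReal.coe_div]
  rw [mul_mul_mul_comm, mul_mul_mul_comm (√(2 * π * (↑v + ↑w)))⁻¹, ← Real.exp_add, ← Real.exp_add, ← mul_inv, ← mul_inv,
    ← Real.sqrt_mul (by positivity), ← Real.sqrt_mul (by positivity)]
  congr 1
  · congr 2
    field_simp
  · congr 1
    field_simp
    ring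

/-- The affine image of a standard Gaussian, expressed through integrals. -/
lemma integral_gaussianReal_eq_integral_affine {f : ℝ → ℝ} (hf : Measurable f) (m τ : ℝ) {v : ℝ≥0}
    (hv : (v : ℝ) = τ ^ 2) :
    ∫ y, f y ∂gaussianReal m v = ∫ y, f (m + τ * y) ∂gaussianReal 0 1 := by
  have hmap : (gaussianReal 0 1).map (fun y => m + τ * y) = gaussianReal m v := by
    have hcomp : (fun y => m + τ * y) = (m + ·) ∘ (τ * ·) := rfl
    rw [hcomp, ← Measure.map_map (by fun_prop) (by fun_prop), gaussianReal_map_const_mul,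
      gaussianReal_map_const_add]
    congr 1
    · ring
    · ext; simp [hv]
  rw [← hmap, integral_map (by fun_prop) hf.aestronglyMeasurable]

/-- One-step description of the normal transform:
`𝒩_{b,μ,σ}(x₁, x₂, x) = E[ b( (x₁/(x₁+x₂))·x + σ·√(x₁x₂/(x₁+x₂))·ξ ) ]`
for a standard normally distributed `ξ`. -/
theorem normalTransform_one_step
    {Ω : Type*} [MeasurableSpace Ω] (P : Measure Ω) [IsProbabilityMeasure P]
    (ξ : Ω → ℝ) (hξ : Measurable ξ) (hξlaw : P.map ξ = gaussianReal 0 1)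
    (μ σ : ℝ) (hσ : 0 < σ)
    (b : ℝ → ℝ) (hbmeas : Measurable b) (hbbdd : ∃ M, ∀ y, |b y| ≤ M)
    (x₁ x₂ : ℝ) (hx₁ : 0 < x₁) (hx₂ : 0 < x₂) (x : ℝ) :
    normalTransform μ σ (fun _ : Fin 1 => b) ![x₁, x₂] x =
      ∫ ω, b (x₁ / (x₁ + x₂) * x + σ * Real.sqrt (x₁ * x₂ / (x₁ + x₂)) * ξ ω) ∂P := by
  set v : ℝ≥0 := ⟨(σ * √x₁) ^ 2, sq_nonneg _⟩
  set w : ℝ≥0 := ⟨(σ * √x₂) ^ 2, sq_nonneg _⟩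
  have hx₁₂ : 0 < x₁ + x₂ := by positivity
  have hv : (v : ℝ) = (σ * √x₁) ^ 2 := rfl
  have hw : (w : ℝ) = (σ * √x₂) ^ 2 := rfl
  have hv' : (v : ℝ) = σ ^ 2 * x₁ := by rw [hv, mul_pow, Real.sq_sqrt hx₁.le]
  have hw' : (w : ℝ) = σ ^ 2 * x₂ := by rw [hw, mul_pow, Real.sq_sqrt hx₂.le]
  have hv0 : v ≠ 0 := by rw [← NNReal.coe_ne_zero, hv']; positivity
  have hw0 : w ≠ 0 := by rw [← NNReal.coe_ne_zero, hw']; positivity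
  have hvw : ((v + w : ℝ≥0) : ℝ) = (σ * √(x₁ + x₂)) ^ 2 := by
    rw [NNReal.coe_add, hv', hw', mul_pow, Real.sq_sqrt hx₁₂.le]; ring
  have hτ : ((v * w / (v + w) : ℝ≥0) : ℝ) = (σ * √(x₁ * x₂ / (x₁ + x₂))) ^ 2 := by
    rw [NNReal.coe_div, NNReal.coe_mul, NNReal.coe_add, hv', hw', mul_pow,
      Real.sq_sqrt (by positivity)]
    field_simp
  have hm : μ * x₁ + (v : ℝ) / (v + w) * (x - μ * x₁ - μ * x₂) = x₁ / (x₁ + x₂) * x := by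
    rw [hv', hw']; field_simp; ring
  have hτ0 : v * w / (v + w) ≠ 0 := by positivity
  have hnum : ∀ z : ℝ, gaussianPDFReal (μ * x₁) v z * b z * gaussianPDFReal (μ * x₂) w (x - z) =
      gaussianPDFReal (μ * (x₁ + x₂)) (v + w) x *
        (gaussianPDFReal (x₁ / (x₁ + x₂) * x) (v * w / (v + w)) z • b z) := fun z => by
    rw [mul_right_comm, gaussianPDFReal_mul_gaussianPDFReal_sub hv0 hw0, hm, mul_add,
      smul_eq_mul, mul_assoc]
  have hfubini : ∀ g : ℝ → ℝ, ∫ z : Fin 1 → ℝ, g (z 0) = ∫ z, g z := fun g =>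
    (volume_preserving_funUnique (Fin 1) ℝ).integral_comp' g
  have hIic : Finset.Iic (0 : Fin 1) = {0} := rfl
  have hdens : 0 < gaussianPDFReal (μ * (x₁ + x₂)) (v + w) x :=
    gaussianPDFReal_pos _ _ _ (by positivity)
  calc normalTransform μ σ (fun _ : Fin 1 => b) ![x₁, x₂] x
      = (∫ z : Fin 1 → ℝ, gaussianPDFReal (μ * x₁) v (z 0) * b (z 0) *
          gaussianPDFReal (μ * x₂) w (x - z 0)) /
          gaussianPDFReal (μ * (x₁ + x₂)) (v + w) x := by
        rw [← stdNormalPDF_div_eq_gaussianPDFReal (by positivity) hvw]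
        simp_rw [← stdNormalPDF_div_eq_gaussianPDFReal
            (show 0 < σ * √x₁ by positivity) hv,
          ← stdNormalPDF_div_eq_gaussianPDFReal (show 0 < σ * √x₂ by positivity) hw]
        simp [normalTransform, hIic, Fin.last, div_eq_inv_mul]
    _ = ∫ y, b y ∂gaussianReal (x₁ / (x₁ + x₂) * x) (v * w / (v + w)) := by
        rw [hfubini fun z => gaussianPDFReal (μ * x₁) v z * b z *
          gaussianPDFReal (μ * x₂) w (x - z)]
        simp_rw [hnum]
        rw [integral_const_mul, mul_div_cancel_left₀ _ hdens.ne',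
          integral_gaussianReal_eq_integral_smul hτ0]
    _ = ∫ y, b (x₁ / (x₁ + x₂) * x + σ * √(x₁ * x₂ / (x₁ + x₂)) * y) ∂P.map ξ := by
        rw [hξlaw, integral_gaussianReal_eq_integral_affine hbmeas _ _ hτ]
    _ = _ := integral_map hξ.aemeasurable (hbmeas.comp (by fun_prop)).aestronglyMeasurable
end

section
/- Let ξ be a random variable with law N(0,1). For every natural number i ≥ 2, every tuple (b₁,…,b_i) of bounded Borel measurable maps ℝ → ℝ, all x₁,…,x_{i+1} ∈ (0,∞), and every x ∈ ℝ, one has 𝒩_{(b₁,…,b_i),μ,σ}(x₁,…,x_{i+1},x) = 𝒩_{(b₁,…,b_{i−2}, b̃_{i−1}),μ,σ}(x₁,…,x_{i−1}, x_i + x_{i+1}, x), where b̃_{i−1}(z) = b_{i−1}(z) · E[ b_i( (x_{i+1}/(x_i+x_{i+1}))·z + (x_i/(x_i+x_{i+1}))·x + σ·√(x_i x_{i+1}/(x_i+x_{i+1}))·ξ ) ]. -/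
open MeasureTheory ProbabilityTheory Real

lemma continuous_stdNormalPDF : Continuous stdNormalPDF := by
  unfold stdNormalPDF
  fun_prop

lemma stdNormalPDF_nonneg (x : ℝ) : 0 ≤ stdNormalPDF x := by
  unfold stdNormalPDF
  positivity

lemma stdNormalPDF_le (x : ℝ) : stdNormalPDF x ≤ 1 / Real.sqrt (2 * Real.pi) := by
  unfold stdNormalPDF
  gcongr
  rw [Real.exp_le_one_iff]
  nlinarith [sq_nonneg x]

lemma gaussianPDFReal_zero_one_eq_stdNormalPDF : gaussianPDFReal 0 1 = stdNormalPDF := by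
  ext x
  simp [gaussianPDFReal, stdNormalPDF, div_eq_mul_inv, mul_comm]

lemma integrable_stdNormalPDF : Integrable stdNormalPDF :=
  gaussianPDFReal_zero_one_eq_stdNormalPDF ▸ integrable_gaussianPDFReal 0 1

/-- Density at `t` of the normal law with mean `μ * s` and variance `σ ^ 2 * s`. -/
noncomputable def normalIncrementPDF (μ σ s t : ℝ) : ℝ :=
  stdNormalPDF ((t - μ * s) / (σ * Real.sqrt s)) / (σ * Real.sqrt s)

lemma continuous_normalIncrementPDF (μ σ s : ℝ) : Continuous (normalIncrementPDF μ σ s) := by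
  unfold normalIncrementPDF
  exact (continuous_stdNormalPDF.comp (by fun_prop)).div_const _

lemma integrable_normalIncrementPDF (μ : ℝ) {σ s : ℝ} (hσ : 0 < σ) (hs : 0 < s) :
    Integrable (normalIncrementPDF μ σ s) := by
  have hne : σ * Real.sqrt s ≠ 0 := by positivity
  exact ((integrable_stdNormalPDF.comp_div hne).comp_sub_right (μ * s)).div_const _

lemma abs_normalIncrementPDF_le (μ : ℝ) {σ s : ℝ} (hσ : 0 < σ) (t : ℝ) :
    |normalIncrementPDF μ σ s t| ≤ 1 / Real.sqrt (2 * Real.pi) / (σ * Real.sqrt s) := by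
  unfold normalIncrementPDF
  rw [abs_of_nonneg (div_nonneg (stdNormalPDF_nonneg _) (by positivity))]
  gcongr
  exact stdNormalPDF_le _

/-- The product of two increment densities is the density of the sum times a bridge density. -/
lemma normalIncrementPDF_mul (μ : ℝ) {σ u v : ℝ} (hσ : 0 < σ) (hu : 0 < u) (hv : 0 < v)
    (y s : ℝ) :
    normalIncrementPDF μ σ u (u / (u + v) * y + σ * Real.sqrt (u * v / (u + v)) * s) *
        normalIncrementPDF μ σ v
          (y - (u / (u + v) * y + σ * Real.sqrt (u * v / (u + v)) * s)) *
        (σ * Real.sqrt (u * v / (u + v))) =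
      normalIncrementPDF μ σ (u + v) y * stdNormalPDF s := by
  have huv : 0 < u + v := by positivity
  obtain ⟨p, hp, rfl⟩ : ∃ p, 0 < p ∧ u = p ^ 2 :=
    ⟨Real.sqrt u, Real.sqrt_pos.2 hu, (Real.sq_sqrt hu.le).symm⟩
  obtain ⟨q, hq, rfl⟩ : ∃ q, 0 < q ∧ v = q ^ 2 :=
    ⟨Real.sqrt v, Real.sqrt_pos.2 hv, (Real.sq_sqrt hv.le).symm⟩
  obtain ⟨r, hr, hrw⟩ : ∃ r, 0 < r ∧ p ^ 2 + q ^ 2 = r ^ 2 :=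
    ⟨Real.sqrt (p ^ 2 + q ^ 2), Real.sqrt_pos.2 huv, (Real.sq_sqrt huv.le).symm⟩
  have hroot : Real.sqrt (p ^ 2 * q ^ 2 / r ^ 2) = p * q / r := by
    rw [show p ^ 2 * q ^ 2 / r ^ 2 = (p * q / r) ^ 2 by ring]
    exact Real.sqrt_sq (by positivity)
  rw [hrw, hroot]
  unfold normalIncrementPDF stdNormalPDF
  rw [Real.sqrt_sq hp.le, Real.sqrt_sq hq.le, Real.sqrt_sq hr.le]
  have hexp : ∀ a b c d : ℝ, a + b = c + d →
      Real.exp a * Real.exp b = Real.exp c * Real.exp d := by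
    intro a b c d h
    rw [← Real.exp_add, ← Real.exp_add, h]
  have key := hexp
    (-((p ^ 2 / r ^ 2 * y + σ * (p * q / r) * s - μ * p ^ 2) / (σ * p)) ^ 2 / 2)
    (-((y - (p ^ 2 / r ^ 2 * y + σ * (p * q / r) * s) - μ * q ^ 2) / (σ * q)) ^ 2 / 2)
    (-((y - μ * r ^ 2) / (σ * r)) ^ 2 / 2) (-s ^ 2 / 2) (by
      have hq2 : q ^ 2 = r ^ 2 - p ^ 2 := by linarith
      field_simp
      grind)
  have hpi : Real.sqrt (2 * Real.pi) ≠ 0 := by positivity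
  generalize Real.sqrt (2 * Real.pi) = c at hpi ⊢
  generalize Real.exp (-((p ^ 2 / r ^ 2 * y + σ * (p * q / r) * s - μ * p ^ 2) / (σ * p)) ^ 2 / 2)
    = A at key ⊢
  generalize Real.exp
    (-((y - (p ^ 2 / r ^ 2 * y + σ * (p * q / r) * s) - μ * q ^ 2) / (σ * q)) ^ 2 / 2)
    = B at key ⊢
  generalize Real.exp (-((y - μ * r ^ 2) / (σ * r)) ^ 2 / 2) = C at key ⊢
  generalize Real.exp (-s ^ 2 / 2) = D at key ⊢
  field_simp
  linear_combination key

lemma integral_comp_of_map_eq_gaussianReal {Ω : Type*} [MeasurableSpace Ω] {P : Measure Ω}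
    {ξ : Ω → ℝ} (hξ : Measurable ξ) (hξlaw : P.map ξ = gaussianReal 0 1)
    {f : ℝ → ℝ} (hf : Measurable f) :
    ∫ ω, f (ξ ω) ∂P = ∫ s, stdNormalPDF s * f s := by
  rw [← integral_map hξ.aemeasurable hf.aestronglyMeasurable, hξlaw,
    integral_gaussianReal_eq_integral_smul one_ne_zero, gaussianPDFReal_zero_one_eq_stdNormalPDF]
  rfl

lemma integral_normalIncrementPDF_mul {Ω : Type*} [MeasurableSpace Ω] {P : Measure Ω}
    {ξ : Ω → ℝ} (hξ : Measurable ξ) (hξlaw : P.map ξ = gaussianReal 0 1)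
    (μ : ℝ) {σ u v : ℝ} (hσ : 0 < σ) (hu : 0 < u) (hv : 0 < v)
    {f : ℝ → ℝ} (hf : Measurable f) (S x : ℝ) :
    ∫ t, normalIncrementPDF μ σ u t * f (S + t) * normalIncrementPDF μ σ v (x - (S + t)) =
      normalIncrementPDF μ σ (u + v) (x - S) *
        ∫ ω, f (v / (u + v) * S + u / (u + v) * x +
          σ * Real.sqrt (u * v / (u + v)) * ξ ω) ∂P := by
  have huv : 0 < u + v := by positivity
  rw [integral_comp_of_map_eq_gaussianReal hξ hξlaw (f := fun s ↦ f (v / (u + v) * S +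
    u / (u + v) * x + σ * Real.sqrt (u * v / (u + v)) * s)) (hf.comp (by fun_prop)),
    ← integral_const_mul]
  have key := normalIncrementPDF_mul μ hσ hu hv (x - S)
  have hr : 0 < σ * Real.sqrt (u * v / (u + v)) := by positivity
  generalize σ * Real.sqrt (u * v / (u + v)) = r at key hr ⊢
  set g : ℝ → ℝ := fun t ↦
    normalIncrementPDF μ σ u t * f (S + t) * normalIncrementPDF μ σ v (x - (S + t)) with hg
  have hsub : ∫ s, g (u / (u + v) * (x - S) + r * s) = r⁻¹ * ∫ t, g t := by
    rw [Measure.integral_comp_mul_left (fun t ↦ g (u / (u + v) * (x - S) + t)) r,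
      integral_add_left_eq_self, abs_of_pos (inv_pos.2 hr), smul_eq_mul]
  have hrg : ∫ t, g t = r * ∫ s, g (u / (u + v) * (x - S) + r * s) := by
    rw [hsub]
    field_simp
  rw [hrg, ← integral_const_mul]
  congr 1
  ext s
  have harg : S + (u / (u + v) * (x - S) + r * s) =
      v / (u + v) * S + u / (u + v) * x + r * s := by
    field_simp
    ring
  simp only [hg]
  rw [← sub_sub, harg]
  linear_combination f (v / (u + v) * S + u / (u + v) * x + r * s) * key s

lemma Fin.sum_Iic_castSucc_snoc {M : Type*} [AddCommMonoid M] {n : ℕ} (w : Fin n → M) (t : M)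
    (j : Fin n) :
    ∑ k ∈ Finset.Iic j.castSucc, (Fin.snoc w t : Fin (n + 1) → M) k =
      ∑ k ∈ Finset.Iic j, w k := by
  have h (n : ℕ) (j : Fin n) : Finset.Iic j = Finset.univ.filter (· ≤ j) := by
    ext; simp
  rw [h, h, Finset.sum_filter, Finset.sum_filter, Fin.sum_univ_castSucc]
  simp [Fin.not_le.2 (Fin.castSucc_lt_last j)]

lemma integral_fin_succ_eq_integral_snoc {n : ℕ} {F : (Fin (n + 1) → ℝ) → ℝ}
    (hF : Integrable F) :
    ∫ z, F z = ∫ w : Fin n → ℝ, ∫ t : ℝ, F (Fin.snoc w t) := by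
  have hmp := (volume_preserving_piFinSuccAbove (fun _ : Fin (n + 1) ↦ ℝ) (Fin.last n)).symm
  have hemb := (MeasurableEquiv.piFinSuccAbove (fun _ : Fin (n + 1) ↦ ℝ)
    (Fin.last n)).symm.measurableEmbedding
  have hint := (hmp.integrable_comp_emb hemb).2 hF
  rw [← hmp.integral_comp hemb]
  rw [Measure.volume_eq_prod] at hint ⊢
  refine (integral_prod_symm _ hint).trans ?_
  simp [MeasurableEquiv.piFinSuccAbove, Fin.insertNthEquiv]

/-- The integrand in the numerator of the normal transform is integrable. -/
lemma integrable_prod_normalIncrementPDF (μ : ℝ) {σ : ℝ} (hσ : 0 < σ) {n : ℕ}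
    {b : Fin n → ℝ → ℝ} (hbmeas : ∀ j, Measurable (b j)) (hbbdd : ∀ j, ∃ M, ∀ y, |b j y| ≤ M)
    {xs : Fin (n + 1) → ℝ} (hxs : ∀ j, 0 < xs j) (x : ℝ) :
    Integrable fun z : Fin n → ℝ ↦
      (∏ j, normalIncrementPDF μ σ (xs j.castSucc) (z j) * b j (∑ k ∈ Finset.Iic j, z k)) *
        normalIncrementPDF μ σ (xs (Fin.last n)) (x - ∑ k, z k) := by
  have hprod : Integrable fun z : Fin n → ℝ ↦
      ∏ j, normalIncrementPDF μ σ (xs j.castSucc) (z j) :=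
    Integrable.fintype_prod fun j ↦ integrable_normalIncrementPDF μ hσ (hxs _)
  choose M hM using hbbdd
  simp only [Finset.prod_mul_distrib, mul_assoc]
  refine hprod.mul_bdd (c := (∏ j, M j) *
    (1 / Real.sqrt (2 * Real.pi) / (σ * Real.sqrt (xs (Fin.last n))))) ?_ (ae_of_all _ fun z ↦ ?_)
  · refine Measurable.aestronglyMeasurable (.mul ?_ ?_)
    · exact Finset.measurable_prod _ fun j _ ↦ (hbmeas j).comp (by fun_prop)
    · exact (continuous_normalIncrementPDF μ σ _).measurable.comp (by fun_prop)
  · rw [Real.norm_eq_abs, abs_mul, Finset.abs_prod]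
    exact mul_le_mul (Finset.prod_le_prod (fun _ _ ↦ abs_nonneg _) fun j _ ↦ hM j _)
      (abs_normalIncrementPDF_le μ hσ _) (abs_nonneg _)
      (Finset.prod_nonneg fun j _ ↦ (abs_nonneg _).trans (hM j 0))

/-- Recursive description of the normal transform: for `i = m + 2 ≥ 2` bounded Borel
measurable maps `b₁,…,bᵢ` (zero-indexed as `b 0, …, b (m+1)`) and positive
`x₁,…,x_{i+1}` (zero-indexed as `xs 0, …, xs (m+2)`),
`𝒩_{(b₁,…,bᵢ),μ,σ}(x₁,…,x_{i+1},x) = 𝒩_{(b₁,…,b_{i−2},b̃_{i−1}),μ,σ}(x₁,…,x_{i−1},xᵢ+x_{i+1},x)`,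
where `b̃_{i−1}(z) = b_{i−1}(z)·E[bᵢ((x_{i+1}/(xᵢ+x_{i+1}))z + (xᵢ/(xᵢ+x_{i+1}))x
+ σ√(xᵢ x_{i+1}/(xᵢ+x_{i+1}))ξ)]` for a standard normally distributed `ξ`. -/
theorem normalTransform_recursion
    {Ω : Type*} [MeasurableSpace Ω] (P : Measure Ω) [IsProbabilityMeasure P]
    (ξ : Ω → ℝ) (hξ : Measurable ξ) (hξlaw : P.map ξ = gaussianReal 0 1)
    (μ σ : ℝ) (hσ : 0 < σ)
    (m : ℕ) (b : Fin (m + 2) → ℝ → ℝ)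
    (hbmeas : ∀ j, Measurable (b j)) (hbbdd : ∀ j, ∃ M, ∀ y, |b j y| ≤ M)
    (xs : Fin (m + 3) → ℝ) (hxs : ∀ j, 0 < xs j) (x : ℝ) :
    normalTransform μ σ b xs x =
      normalTransform μ σ
        (Fin.snoc (fun j : Fin m => b j.castSucc.castSucc)
          (fun z => b (⟨m, by omega⟩ : Fin (m + 2)) z *
            ∫ ω, b (Fin.last (m + 1))
              (xs (⟨m + 2, by omega⟩ : Fin (m + 3)) /
                  (xs (⟨m + 1, by omega⟩ : Fin (m + 3)) +
                    xs (⟨m + 2, by omega⟩ : Fin (m + 3))) * z +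
                xs (⟨m + 1, by omega⟩ : Fin (m + 3)) /
                  (xs (⟨m + 1, by omega⟩ : Fin (m + 3)) +
                    xs (⟨m + 2, by omega⟩ : Fin (m + 3))) * x +
                σ * Real.sqrt (xs (⟨m + 1, by omega⟩ : Fin (m + 3)) *
                    xs (⟨m + 2, by omega⟩ : Fin (m + 3)) /
                  (xs (⟨m + 1, by omega⟩ : Fin (m + 3)) +
                    xs (⟨m + 2, by omega⟩ : Fin (m + 3)))) * ξ ω) ∂P))
        (Fin.snoc (fun j : Fin (m + 1) => xs j.castSucc.castSucc)
          (xs (⟨m + 1, by omega⟩ : Fin (m + 3)) + xs (⟨m + 2, by omega⟩ : Fin (m + 3)))) x := by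
  have hlast : (⟨m + 2, by omega⟩ : Fin (m + 3)) = Fin.last (m + 2) := rfl
  have hpen : (⟨m + 1, by omega⟩ : Fin (m + 3)) = (Fin.last (m + 1)).castSucc := rfl
  have hmid : (⟨m, by omega⟩ : Fin (m + 2)) = (Fin.last m).castSucc := rfl
  rw [hlast, hpen, hmid]
  unfold normalTransform
  congr 1
  · refine (integral_fin_succ_eq_integral_snoc
      (integrable_prod_normalIncrementPDF μ hσ hbmeas hbbdd hxs x)).trans ?_
    congr 1
    ext w
    have hsum_last (n : ℕ) (f : Fin (n + 1) → ℝ) :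
        ∑ k ∈ Finset.Iic (Fin.last n), f k = ∑ k, f k := by
      congr 1
      ext k
      simp [Fin.le_last]
    have key := integral_normalIncrementPDF_mul hξ hξlaw μ hσ (hxs (Fin.last (m + 1)).castSucc)
      (hxs (Fin.last (m + 2))) (hbmeas (Fin.last (m + 1))) (∑ k, w k) x
    have hsplit (t : ℝ) :
        (∏ j, normalIncrementPDF μ σ (xs j.castSucc) ((Fin.snoc w t : Fin (m + 2) → ℝ) j) *
          b j (∑ k ∈ Finset.Iic j, (Fin.snoc w t : Fin (m + 2) → ℝ) k)) *
          normalIncrementPDF μ σ (xs (Fin.last (m + 2)))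
            (x - ∑ k, (Fin.snoc w t : Fin (m + 2) → ℝ) k) =
        (∏ j : Fin (m + 1), normalIncrementPDF μ σ (xs j.castSucc.castSucc) (w j) *
          b j.castSucc (∑ k ∈ Finset.Iic j, w k)) *
        (normalIncrementPDF μ σ (xs (Fin.last (m + 1)).castSucc) t *
          b (Fin.last (m + 1)) (∑ k, w k + t) *
          normalIncrementPDF μ σ (xs (Fin.last (m + 2))) (x - (∑ k, w k + t))) := by
      rw [Fin.prod_univ_castSucc, hsum_last, Fin.sum_univ_castSucc]
      simp only [Fin.sum_Iic_castSucc_snoc, Fin.snoc_castSucc, Fin.snoc_last]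
      ring
    simp_rw [hsplit]
    rw [integral_const_mul, key, Fin.prod_univ_castSucc, Fin.prod_univ_castSucc, hsum_last]
    simp only [Fin.snoc_castSucc, Fin.snoc_last, normalIncrementPDF]
    ring
  · have hsum : ∑ k, xs k = ∑ k, (Fin.snoc (fun j : Fin (m + 1) => xs j.castSucc.castSucc)
        (xs (Fin.last (m + 1)).castSucc + xs (Fin.last (m + 2))) : Fin (m + 2) → ℝ) k := by
      rw [Fin.sum_univ_castSucc, Fin.sum_univ_castSucc, Fin.sum_univ_castSucc (n := m + 1)]
      simp only [Fin.snoc_castSucc, Fin.snoc_last]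
      ring
    rw [hsum]
end

section
/- Fix μ ∈ ℝ and σ > 0, and let i ≥ 2 be a natural number. For each collection of real numbers 0 < x₁ < x₂ < … < x_i, there exist random variables ρ_{i,1}, …, ρ_{i,i−1}, each with atomless (continuous) law, depending only on σ and x₁,…,x_i, such that for each n ≥ 1, each collection b₁,…,b_{i−1} of bounded Borel measurable maps ℝ → ℝ, and each x ∈ ℝ, 𝒩_{(b₁,…,b_{i−1}),μ,σ}(x₁n, x₂n, …, x_i n, x) = E[ ∏_{j=1}^{i−1} b_j( ((Σ_{k=1}^j x_k)/(Σ_{k=1}^i x_k))·x + ρ_{i,j}·√n ) ]. -/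
open MeasureTheory ProbabilityTheory Real

/-- The density of the centred normal law with variance `σ ^ 2 * v`. -/
noncomputable def scaledNormalPDF (σ v y : ℝ) : ℝ :=
  stdNormalPDF (y / (σ * Real.sqrt v)) / (σ * Real.sqrt v)

lemma scaledNormalPDF_def (σ v y : ℝ) :
    scaledNormalPDF σ v y = stdNormalPDF (y / (σ * Real.sqrt v)) / (σ * Real.sqrt v) := rfl

lemma scaledNormalPDF_eq_mul_exp {σ v : ℝ} (hv : 0 < v) (y : ℝ) :
    scaledNormalPDF σ v y = scaledNormalPDF σ v 0 * Real.exp (-y ^ 2 / (2 * σ ^ 2 * v)) := by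
  have h : -(y / (σ * √v)) ^ 2 / 2 = -y ^ 2 / (2 * σ ^ 2 * v) := by
    rw [div_pow, mul_pow, Real.sq_sqrt hv.le, neg_div, neg_div, div_div]
    ring_nf
  simp only [scaledNormalPDF, stdNormalPDF, h]
  simp
  ring

lemma scaledNormalPDF_pos {σ v : ℝ} (hσ : 0 < σ) (hv : 0 < v) (y : ℝ) :
    0 < scaledNormalPDF σ v y := by
  unfold scaledNormalPDF stdNormalPDF
  positivity

@[fun_prop]
lemma continuous_scaledNormalPDF (σ v : ℝ) : Continuous (scaledNormalPDF σ v) := by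
  unfold scaledNormalPDF stdNormalPDF
  fun_prop

@[fun_prop]
lemma measurable_scaledNormalPDF (σ v : ℝ) : Measurable (scaledNormalPDF σ v) :=
  (continuous_scaledNormalPDF σ v).measurable

lemma scaledNormalPDF_eq_gaussianPDFReal {σ v : ℝ} (hσ : 0 < σ) (hv : 0 < v) :
    scaledNormalPDF σ v = gaussianPDFReal 0 (σ ^ 2 * v).toNNReal := by
  ext y
  rw [scaledNormalPDF_eq_mul_exp hv, gaussianPDFReal_def,
    Real.coe_toNNReal _ (by positivity)]
  have h : √(2 * π * (σ ^ 2 * v)) = √(2 * π) * (σ * √v) := by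
    rw [Real.sqrt_mul (by positivity) (σ ^ 2 * v), Real.sqrt_mul (by positivity) v,
      Real.sqrt_sq hσ.le]
  beta_reduce
  rw [h, sub_zero, ← mul_assoc 2 (σ ^ 2) v, scaledNormalPDF, stdNormalPDF]
  simp only [zero_div, ne_eq, OfNat.ofNat_ne_zero, not_false_eq_true, zero_pow, neg_zero,
    Real.exp_zero, one_div]
  rw [mul_inv, div_eq_mul_inv]

lemma integral_scaledNormalPDF {σ v : ℝ} (hσ : 0 < σ) (hv : 0 < v) :
    ∫ y, scaledNormalPDF σ v y = 1 := by
  rw [scaledNormalPDF_eq_gaussianPDFReal hσ hv]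
  exact integral_gaussianPDFReal_eq_one 0 (Real.toNNReal_pos.mpr (by positivity)).ne'

lemma integrable_scaledNormalPDF {σ v : ℝ} (hσ : 0 < σ) (hv : 0 < v) :
    Integrable (scaledNormalPDF σ v) := by
  rw [scaledNormalPDF_eq_gaussianPDFReal hσ hv]
  exact integrable_gaussianPDFReal _ _

lemma lintegral_scaledNormalPDF {σ v : ℝ} (hσ : 0 < σ) (hv : 0 < v) :
    ∫⁻ y, ENNReal.ofReal (scaledNormalPDF σ v y) = 1 := by
  rw [← ofReal_integral_eq_lintegral_ofReal (integrable_scaledNormalPDF hσ hv)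
    (ae_of_all _ fun y ↦ (scaledNormalPDF_pos hσ hv y).le), integral_scaledNormalPDF hσ hv,
    ENNReal.ofReal_one]

lemma scaledNormalPDF_mul_sq {c : ℝ} (hc : 0 < c) (σ v y : ℝ) (hv : 0 < v) :
    scaledNormalPDF σ (v * c ^ 2) (c * y) = scaledNormalPDF σ v y / c := by
  have h : σ * √(v * c ^ 2) = c * (σ * √v) := by
    rw [Real.sqrt_mul hv.le, Real.sqrt_sq hc.le]
    ring
  rw [scaledNormalPDF, scaledNormalPDF, h, mul_div_mul_left _ _ hc.ne', div_div, mul_comm c]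

/-- Completing the square: a product of centred normal densities, evaluated at a point with
coordinate sum `y`, factors through the density of the sum. -/
lemma prod_scaledNormalPDF_eq {ι : Type*} [Fintype ι] [Nonempty ι] {σ : ℝ} (hσ : 0 < σ)
    {v : ι → ℝ} (hv : ∀ k, 0 < v k) (u : ι → ℝ) (hu : ∑ k, u k = 0) (y : ℝ) :
    ∏ k, scaledNormalPDF σ (v k) (v k / (∑ l, v l) * y + u k) =
      (∏ k, scaledNormalPDF σ (v k) (u k)) / scaledNormalPDF σ (∑ l, v l) 0 *
        scaledNormalPDF σ (∑ l, v l) y := by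
  have hS : 0 < ∑ l, v l := Finset.sum_pos (fun k _ ↦ hv k) Finset.univ_nonempty
  set S := ∑ l, v l
  have hsum : ∑ k, -(v k / S * y + u k) ^ 2 / (2 * σ ^ 2 * v k) =
      ∑ k, -(u k) ^ 2 / (2 * σ ^ 2 * v k) + -y ^ 2 / (2 * σ ^ 2 * S) := by
    have h : ∀ k, -(v k / S * y + u k) ^ 2 / (2 * σ ^ 2 * v k) =
        -(u k) ^ 2 / (2 * σ ^ 2 * v k) +
          (-(y ^ 2 / (2 * σ ^ 2 * S ^ 2)) * v k - y / (σ ^ 2 * S) * u k) := fun k ↦ by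
      have := hv k
      field_simp
      ring
    simp only [h, Finset.sum_add_distrib, Finset.sum_sub_distrib, ← Finset.mul_sum, hu]
    field_simp
    ring
  rw [Finset.prod_congr rfl fun k _ ↦ scaledNormalPDF_eq_mul_exp (hv k) (v k / S * y + u k),
    Finset.prod_congr rfl fun k _ ↦ scaledNormalPDF_eq_mul_exp (hv k) (u k),
    scaledNormalPDF_eq_mul_exp hS y, Finset.prod_mul_distrib, Finset.prod_mul_distrib,
    ← Real.exp_sum, ← Real.exp_sum, hsum, Real.exp_add]
  have := (scaledNormalPDF_pos hσ hS 0).ne'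
  field_simp

/-- The joint density of the increments of a Gaussian random walk, with step variances
`σ ^ 2 * v k`, conditioned to return to zero; the last increment is omitted. -/
noncomputable def bridgePDF (σ : ℝ) {N : ℕ} (v : Fin (N + 1) → ℝ) (w : Fin N → ℝ) : ℝ :=
  ((∏ j : Fin N, scaledNormalPDF σ (v j.castSucc) (w j)) *
    scaledNormalPDF σ (v (Fin.last N)) (-∑ j, w j)) / scaledNormalPDF σ (∑ k, v k) 0

lemma bridgePDF_nonneg {σ : ℝ} (hσ : 0 < σ) {N : ℕ} {v : Fin (N + 1) → ℝ} (hv : ∀ k, 0 < v k)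
    (w : Fin N → ℝ) : 0 ≤ bridgePDF σ v w :=
  div_nonneg (mul_nonneg (Finset.prod_nonneg fun _ _ ↦ (scaledNormalPDF_pos hσ (hv _) _).le)
    (scaledNormalPDF_pos hσ (hv _) _).le)
    (scaledNormalPDF_pos hσ (Finset.sum_pos (fun k _ ↦ hv k) Finset.univ_nonempty) _).le

@[fun_prop]
lemma measurable_bridgePDF (σ : ℝ) {N : ℕ} (v : Fin (N + 1) → ℝ) :
    Measurable (bridgePDF σ v) := by
  unfold bridgePDF
  fun_prop

/-- Conditioning a Gaussian random walk on its endpoint `y` yields a bridge plus a linear drift. -/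
lemma prod_mul_scaledNormalPDF_eq_bridgePDF_mul {σ : ℝ} (hσ : 0 < σ) {N : ℕ}
    {v : Fin (N + 1) → ℝ} (hv : ∀ k, 0 < v k) (w : Fin N → ℝ) (y : ℝ) :
    (∏ j : Fin N,
        scaledNormalPDF σ (v j.castSucc) (v j.castSucc / (∑ k, v k) * y + w j)) *
      scaledNormalPDF σ (v (Fin.last N)) (v (Fin.last N) / (∑ k, v k) * y - ∑ j, w j) =
      bridgePDF σ v w * scaledNormalPDF σ (∑ k, v k) y := by
  have h := prod_scaledNormalPDF_eq hσ hv (Fin.snoc (α := fun _ ↦ ℝ) w (-∑ j, w j))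
    (by simp [Fin.sum_univ_castSucc]) y
  rw [Fin.prod_univ_castSucc, Fin.prod_univ_castSucc] at h
  simpa only [Fin.snoc_castSucc, Fin.snoc_last, ← sub_eq_add_neg, bridgePDF] using h

lemma bridgePDF_mul_sq {σ c : ℝ} (hσ : 0 < σ) (hc : 0 < c) {N : ℕ} {v : Fin (N + 1) → ℝ}
    (hv : ∀ k, 0 < v k) (w : Fin N → ℝ) :
    bridgePDF σ (fun k ↦ v k * c ^ 2) (c • w) = bridgePDF σ v w / c ^ N := by
  have hS : 0 < ∑ k, v k := Finset.sum_pos (fun k _ ↦ hv k) Finset.univ_nonempty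
  have h0 : scaledNormalPDF σ ((∑ k, v k) * c ^ 2) 0 = scaledNormalPDF σ (∑ k, v k) 0 / c := by
    simpa using scaledNormalPDF_mul_sq hc σ _ 0 hS
  have hs : -∑ j, c * w j = c * -∑ j, w j := by rw [← Finset.mul_sum, mul_neg]
  simp only [bridgePDF, Pi.smul_apply, smul_eq_mul, ← Finset.sum_mul, h0, hs,
    scaledNormalPDF_mul_sq hc σ _ _ (hv _), Finset.prod_div_distrib, Finset.prod_const,
    Finset.card_univ, Fintype.card_fin]
  have := (scaledNormalPDF_pos hσ hS 0).ne'
  field_simp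

lemma lintegral_bridgePDF {σ : ℝ} (hσ : 0 < σ) {N : ℕ} {v : Fin (N + 1) → ℝ}
    (hv : ∀ k, 0 < v k) : ∫⁻ w, ENNReal.ofReal (bridgePDF σ v w) = 1 := by
  have hS : 0 < ∑ k, v k := Finset.sum_pos (fun k _ ↦ hv k) Finset.univ_nonempty
  have hprod : ∀ z : Fin N → ℝ, 0 ≤ ∏ j, scaledNormalPDF σ (v j.castSucc) (z j) := fun z ↦
    Finset.prod_nonneg fun _ _ ↦ (scaledNormalPDF_pos hσ (hv _) _).le
  have hlast : v (Fin.last N) = ∑ k, v k - ∑ j : Fin N, v j.castSucc := by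
    rw [Fin.sum_univ_castSucc]; ring
  have hint : Integrable fun z : Fin N → ℝ ↦ ∏ j, scaledNormalPDF σ (v j.castSucc) (z j) :=
    Integrable.fintype_prod (f := fun j : Fin N ↦ scaledNormalPDF σ (v j.castSucc))
      fun j ↦ integrable_scaledNormalPDF hσ (hv j.castSucc)
  have htranslate : ∀ y : ℝ,
      ∫⁻ z : Fin N → ℝ, ENNReal.ofReal ((∏ j, scaledNormalPDF σ (v j.castSucc) (z j)) *
        scaledNormalPDF σ (v (Fin.last N)) (y - ∑ j, z j)) =
      (∫⁻ w, ENNReal.ofReal (bridgePDF σ v w)) *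
        ENNReal.ofReal (scaledNormalPDF σ (∑ k, v k) y) := by
    intro y
    rw [← lintegral_mul_const _ (by fun_prop), ← lintegral_add_left_eq_self _
      (fun j : Fin N ↦ v j.castSucc / (∑ k, v k) * y)]
    refine lintegral_congr fun w ↦ ?_
    rw [← ENNReal.ofReal_mul (bridgePDF_nonneg hσ hv w),
      ← prod_mul_scaledNormalPDF_eq_bridgePDF_mul hσ hv]
    congr 3
    simp only [Pi.add_apply, Finset.sum_add_distrib, ← Finset.sum_mul, ← Finset.sum_div]
    rw [hlast]
    field_simp
    ring
  calc ∫⁻ w, ENNReal.ofReal (bridgePDF σ v w)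
      = ∫⁻ y, (∫⁻ w, ENNReal.ofReal (bridgePDF σ v w)) *
          ENNReal.ofReal (scaledNormalPDF σ (∑ k, v k) y) := by
        rw [lintegral_const_mul _ (by fun_prop), lintegral_scaledNormalPDF hσ hS, mul_one]
    _ = ∫⁻ z : Fin N → ℝ, ∫⁻ y : ℝ,
          ENNReal.ofReal ((∏ j, scaledNormalPDF σ (v j.castSucc) (z j)) *
            scaledNormalPDF σ (v (Fin.last N)) (y - ∑ j, z j)) := by
        simp only [← htranslate]
        refine lintegral_lintegral_swap (Measurable.aemeasurable ?_)
        unfold Function.uncurry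
        fun_prop
    _ = ∫⁻ z : Fin N → ℝ, ENNReal.ofReal (∏ j, scaledNormalPDF σ (v j.castSucc) (z j)) := by
        refine lintegral_congr fun z ↦ ?_
        simp only [ENNReal.ofReal_mul (hprod z)]
        rw [lintegral_const_mul _ (by fun_prop),
          lintegral_sub_right_eq_self
            (fun y ↦ ENNReal.ofReal (scaledNormalPDF σ (v (Fin.last N)) y)),
          lintegral_scaledNormalPDF hσ (hv _), mul_one]
    _ = 1 := by
        rw [← ofReal_integral_eq_lintegral_ofReal
            hint (ae_of_all _ hprod),
          integral_fintype_prod_volume_eq_prod fun j ↦ scaledNormalPDF σ (v (Fin.castSucc j))]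
        simp [integral_scaledNormalPDF hσ (hv _)]

lemma volume_linearMap_eq_const {ι : Type*} [Fintype ι] (L : (ι → ℝ) →ₗ[ℝ] ℝ) (hL : L ≠ 0)
    (a : ℝ) : volume (L ⁻¹' {a}) = 0 := by
  obtain ⟨e, he⟩ : ∃ e, L e ≠ 0 := by
    by_contra! h
    exact hL (LinearMap.ext h)
  have hs : L ⁻¹' {a} = (fun w ↦ -((a / L e) • e) + w) ⁻¹' (LinearMap.ker L : Set (ι → ℝ)) := by
    ext w
    simp [he, neg_add_eq_zero, eq_comm (a := L w)]
  rw [hs, measure_preimage_add]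
  refine Measure.addHaar_submodule _ _ fun h ↦ hL (LinearMap.ker_eq_top.mp h)

/-- The normal transform along a multiple of `v` is an integral against the bridge density. -/
lemma normalTransform_mul_sq_eq {σ c : ℝ} (hσ : 0 < σ) (hc : 0 < c) {N : ℕ}
    {v : Fin (N + 1) → ℝ} (hv : ∀ k, 0 < v k) (μ : ℝ) (b : Fin N → ℝ → ℝ) (x : ℝ) :
    normalTransform μ σ b (fun k ↦ v k * c ^ 2) x =
      ∫ w, bridgePDF σ v w * ∏ j, b j ((∑ k ∈ Finset.Iic j.castSucc, v k) / (∑ k, v k) * x +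
        (∑ k ∈ Finset.Iic j, w k) * c) := by
  have hS : 0 < ∑ k, v k := Finset.sum_pos (fun k _ ↦ hv k) Finset.univ_nonempty
  have hlast : v (Fin.last N) = ∑ k, v k - ∑ j : Fin N, v j.castSucc := by
    rw [Fin.sum_univ_castSucc]; ring
  have hv' : ∀ k, 0 < v k * c ^ 2 := fun k ↦ mul_pos (hv k) (by positivity)
  have hden : (1 / (σ * √(∑ k, v k * c ^ 2))) *
      stdNormalPDF ((x - μ * ∑ k, v k * c ^ 2) / (σ * √(∑ k, v k * c ^ 2))) =
      scaledNormalPDF σ (∑ k, v k * c ^ 2) (x - μ * ∑ k, v k * c ^ 2) := by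
    rw [scaledNormalPDF, one_div_mul_eq_div]
  have hS' : 0 < ∑ k, v k * c ^ 2 := Finset.sum_pos (fun k _ ↦ hv' k) Finset.univ_nonempty
  rw [normalTransform, hden, div_eq_iff (scaledNormalPDF_pos hσ hS' _).ne',
    ← integral_add_right_eq_self _ (fun j : Fin N ↦ v j.castSucc / (∑ k, v k) * x)]
  have hcomp (H : (Fin N → ℝ) → ℝ) : ∫ z, H z = ∫ w, c ^ N * H (c • w) := by
    rw [integral_const_mul, Measure.integral_comp_smul_of_nonneg volume H c (hR := hc.le),
      Module.finrank_fin_fun, smul_eq_mul, mul_inv_cancel_left₀ (pow_ne_zero _ hc.ne')]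
  rw [hcomp, ← integral_mul_const]
  refine integral_congr_ae (ae_of_all _ fun w ↦ ?_)
  have key := prod_mul_scaledNormalPDF_eq_bridgePDF_mul hσ hv' (c • w)
    (x - μ * ∑ k, v k * c ^ 2)
  rw [bridgePDF_mul_sq hσ hc hv] at key
  have hratio (k : Fin (N + 1)) :
      v k * c ^ 2 / (∑ k, v k * c ^ 2) * (x - μ * ∑ k, v k * c ^ 2) =
        v k / (∑ k, v k) * x - μ * (v k * c ^ 2) := by
    rw [← Finset.sum_mul]
    field_simp
  have hstep (j : Fin N) :
      (c • w + fun j : Fin N ↦ v j.castSucc / (∑ k, v k) * x) j - μ * (v j.castSucc * c ^ 2) =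
        v j.castSucc * c ^ 2 / (∑ k, v k * c ^ 2) * (x - μ * ∑ k, v k * c ^ 2) + (c • w) j := by
    rw [hratio, Pi.add_apply]
    ring
  have hend : x - ∑ j, (c • w + fun j : Fin N ↦ v j.castSucc / (∑ k, v k) * x) j -
      μ * (v (Fin.last N) * c ^ 2) =
        v (Fin.last N) * c ^ 2 / (∑ k, v k * c ^ 2) * (x - μ * ∑ k, v k * c ^ 2) -
          ∑ j, (c • w) j := by
    rw [hratio, hlast]
    simp only [Pi.add_apply, Finset.sum_add_distrib, ← Finset.sum_mul, ← Finset.sum_div]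
    field_simp
    ring
  have hpartial (j : Fin N) :
      ∑ k ∈ Finset.Iic j, (c • w + fun j : Fin N ↦ v j.castSucc / (∑ k, v k) * x) k =
        (∑ k ∈ Finset.Iic j.castSucc, v k) / (∑ k, v k) * x +
          (∑ k ∈ Finset.Iic j, w k) * c := by
    simp only [Pi.add_apply, Pi.smul_apply, smul_eq_mul, Finset.sum_add_distrib,
      ← Finset.sum_mul, ← Finset.sum_div, ← Finset.mul_sum, Fin.sum_Iic_castSucc]
    ring
  simp only [← scaledNormalPDF_def, Finset.prod_mul_distrib, hstep, hend, hpartial]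
  rw [mul_right_comm (∏ j, scaledNormalPDF _ _ _), key]
  rw [div_mul_eq_mul_div, div_mul_eq_mul_div, mul_div_cancel₀ _ (pow_ne_zero _ hc.ne'),
    mul_right_comm]

/-- For `i = m + 2 ≥ 2` and reals `0 < x₁ < … < x_i` (zero-indexed as `xs 0 < … < xs (m+1)`),
there exist random variables `ρ_{i,1}, …, ρ_{i,i−1}` with atomless (continuous) laws,
depending only on `σ` and the `x_j`, such that for every `μ`, every `n ≥ 1`, every collection
`b₁,…,b_{i−1}` of bounded Borel measurable maps, and every `x`,
`𝒩_{(b₁,…,b_{i−1}),μ,σ}(x₁n,…,x_i n,x)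
  = E[ ∏_{j=1}^{i−1} b_j( ((Σ_{k≤j} x_k)/(Σ_{k≤i} x_k))·x + ρ_{i,j}·√n ) ]`. -/
theorem normalTransform_scaling_representation
    (σ : ℝ) (hσ : 0 < σ) (m : ℕ)
    (xs : Fin (m + 2) → ℝ) (hpos : ∀ j, 0 < xs j) (hmono : StrictMono xs) :
    ∃ (Ω : Type) (_ : MeasurableSpace Ω) (P : Measure Ω) (_ : IsProbabilityMeasure P)
      (ρ : Fin (m + 1) → Ω → ℝ),
      (∀ j, Measurable (ρ j)) ∧
      (∀ j, NoAtoms (P.map (ρ j))) ∧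
      (∀ (μ : ℝ) (n : ℕ), 1 ≤ n →
        ∀ (b : Fin (m + 1) → ℝ → ℝ), (∀ j, Measurable (b j)) →
          (∀ j, ∃ M, ∀ y, |b j y| ≤ M) →
        ∀ x : ℝ,
          normalTransform μ σ b (fun j => xs j * n) x =
            ∫ ω, ∏ j : Fin (m + 1),
              b j ((∑ k ∈ Finset.Iic j.castSucc, xs k) / (∑ k, xs k) * x +
                ρ j ω * Real.sqrt n) ∂P) := by
  have hc (n : ℕ) (hn : 1 ≤ n) : 0 < √(n : ℝ) := Real.sqrt_pos.mpr (by exact_mod_cast hn)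
  have hmeas : Measurable fun w ↦ ENNReal.ofReal (bridgePDF σ xs w) := by fun_prop
  have hρ (j : Fin (m + 1)) : Measurable fun w : Fin (m + 1) → ℝ ↦ ∑ k ∈ Finset.Iic j, w k := by
    fun_prop
  refine ⟨Fin (m + 1) → ℝ, inferInstance,
    volume.withDensity fun w ↦ ENNReal.ofReal (bridgePDF σ xs w), ⟨?_⟩,
    fun j w ↦ ∑ k ∈ Finset.Iic j, w k, hρ, fun j ↦ ⟨fun a ↦ ?_⟩, ?_⟩
  · rw [withDensity_apply _ .univ, Measure.restrict_univ, lintegral_bridgePDF hσ hpos]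
  · rw [Measure.map_apply (hρ j) (measurableSet_singleton a)]
    refine withDensity_absolutelyContinuous _ _ ?_
    let L : (Fin (m + 1) → ℝ) →ₗ[ℝ] ℝ := ∑ k ∈ Finset.Iic j, LinearMap.proj k
    have hL : ⇑L = fun w ↦ ∑ k ∈ Finset.Iic j, w k := by
      ext w
      simp [L]
    rw [← hL]
    refine volume_linearMap_eq_const L (fun h ↦ ?_) a
    have h1 : ∑ k ∈ Finset.Iic j, (Pi.single j 1 : Fin (m + 1) → ℝ) k = 0 := by
      rw [← congrFun hL, h, LinearMap.zero_apply]
    simp [Finset.sum_pi_single'] at h1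
  · intro μ n hn b _ _ x
    rw [integral_withDensity_eq_integral_toReal_smul hmeas
      (ae_of_all _ fun _ ↦ ENNReal.ofReal_lt_top)]
    simp only [ENNReal.toReal_ofReal (bridgePDF_nonneg hσ hpos _), smul_eq_mul]
    rw [← normalTransform_mul_sq_eq hσ (hc n hn) hpos, Real.sq_sqrt n.cast_nonneg]
end

section
/- Fix μ ∈ ℝ, σ > 0, an integer L ≥ 2, natural numbers 0 < k₁ < … < k_{L+1}, a Borel measurable ψ : ℝ → [0,1], and γ ≥ 0. Then for each i ∈ {2,…,L} there exist random variables σ_{i,1}, …, σ_{i,i−1}, each with atomless (continuous) law, depending only on γ, σ and k₁,…,k_{L+1}, such that for all n ≥ 1 and x ∈ ℝ, 𝒩_{n,i}(x) = E[ ∏_{j=1}^{i−1} (1 − ψ)( (k_j^{1−γ}/k_i)·n^{−γ}·x + σ_{i,j}·n^{1/2−γ} ) ]. -/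
open MeasureTheory ProbabilityTheory Real

/-- The density at `z` of the centred normal distribution with variance `σ ^ 2 * s`. -/
noncomputable def gaussKernel (σ s z : ℝ) : ℝ :=
  stdNormalPDF (z / (σ * Real.sqrt s)) / (σ * Real.sqrt s)

lemma gaussKernel_eq {σ s : ℝ} (hs : 0 ≤ s) (z : ℝ) :
    gaussKernel σ s z =
      Real.exp (-z ^ 2 / (2 * (σ ^ 2 * s))) / (Real.sqrt (2 * Real.pi) * (σ * Real.sqrt s)) := by
  unfold gaussKernel stdNormalPDF
  rw [div_div, div_pow, mul_pow, Real.sq_sqrt hs, ← neg_div, div_div, mul_comm (σ ^ 2 * s) 2]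

lemma gaussKernel_pos {σ s : ℝ} (hσ : 0 < σ) (hs : 0 < s) (z : ℝ) : 0 < gaussKernel σ s z := by
  rw [gaussKernel_eq hs.le]
  positivity

lemma continuous_gaussKernel (σ s : ℝ) : Continuous (gaussKernel σ s) := by
  unfold gaussKernel stdNormalPDF
  fun_prop

lemma lintegral_gaussKernel {σ s : ℝ} (hσ : 0 < σ) (hs : 0 < s) (c : ℝ) :
    ∫⁻ z, ENNReal.ofReal (gaussKernel σ s (z - c)) = 1 := by
  have hv : (σ ^ 2 * s).toNNReal ≠ 0 := (Real.toNNReal_pos.2 (by positivity)).ne'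
  rw [← lintegral_gaussianPDFReal_eq_one c hv]
  refine lintegral_congr fun z => ?_
  rw [gaussKernel_eq hs.le, gaussianPDFReal_def]
  have h : √(2 * π * (σ ^ 2 * s)) = √(2 * π) * (σ * √s) := by
    rw [Real.sqrt_mul (by positivity), Real.sqrt_mul (sq_nonneg σ), Real.sqrt_sq hσ.le]
  rw [Real.coe_toNNReal _ (by positivity), h]
  rw [div_eq_inv_mul]

lemma gaussKernel_scale {σ s n : ℝ} (hn : 0 < n) (z : ℝ) :
    gaussKernel σ (n * s) (Real.sqrt n * z) = gaussKernel σ s z / Real.sqrt n := by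
  have hn' : √n ≠ 0 := by positivity
  unfold gaussKernel
  rw [Real.sqrt_mul hn.le, show σ * (√n * √s) = √n * (σ * √s) by ring,
    mul_div_mul_left _ _ hn', div_div, mul_comm √n]

lemma gaussKernel_shift {σ s : ℝ} (hσ : 0 < σ) (hs : 0 < s) (t z : ℝ) :
    gaussKernel σ s (s * t + z) =
      gaussKernel σ s z * Real.exp (-(s * t ^ 2 + 2 * t * z) / (2 * σ ^ 2)) := by
  rw [gaussKernel_eq hs.le, gaussKernel_eq hs.le, div_mul_eq_mul_div, ← Real.exp_add]
  congr 2
  field_simp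
  ring

lemma gaussKernel_mul_gaussKernel {σ s t : ℝ} (hσ : 0 < σ) (hs : 0 < s) (ht : 0 < t) (y w : ℝ) :
    gaussKernel σ s w * gaussKernel σ t (y - w) =
      gaussKernel σ (s + t) y * gaussKernel σ (s * t / (s + t)) (w - s / (s + t) * y) := by
  have hst : 0 < s + t := by positivity
  rw [gaussKernel_eq hs.le, gaussKernel_eq ht.le, gaussKernel_eq hst.le,
    gaussKernel_eq (by positivity : 0 ≤ s * t / (s + t)), div_mul_div_comm, div_mul_div_comm,
    ← Real.exp_add, ← Real.exp_add]
  congr 1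
  · congr 1
    field_simp
    ring
  · rw [Real.sqrt_div (by positivity), Real.sqrt_mul hs.le]
    field_simp

lemma lintegral_gaussKernel_conv {σ s t : ℝ} (hσ : 0 < σ) (hs : 0 < s) (ht : 0 < t) (y : ℝ) :
    ∫⁻ w, ENNReal.ofReal (gaussKernel σ s w) * ENNReal.ofReal (gaussKernel σ t (y - w)) =
      ENNReal.ofReal (gaussKernel σ (s + t) y) := by
  have hst : 0 < s + t := by positivity
  simp_rw [← ENNReal.ofReal_mul (gaussKernel_pos hσ hs _).le,
    gaussKernel_mul_gaussKernel hσ hs ht, ENNReal.ofReal_mul (gaussKernel_pos hσ hst _).le]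
  rw [lintegral_const_mul' _ _ ENNReal.ofReal_ne_top,
    lintegral_gaussKernel hσ (by positivity), mul_one]

lemma lintegral_prod_gaussKernel {σ : ℝ} (hσ : 0 < σ) {i : ℕ} (a : Fin i → ℝ)
    (ha : ∀ j, 0 < a j) {t : ℝ} (ht : 0 < t) (y : ℝ) :
    ∫⁻ w : Fin i → ℝ, (∏ j, ENNReal.ofReal (gaussKernel σ (a j) (w j))) *
        ENNReal.ofReal (gaussKernel σ t (y - ∑ j, w j)) =
      ENNReal.ofReal (gaussKernel σ ((∑ j, a j) + t) y) := by
  induction i generalizing y with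
  | zero => simp [volume_pi]
  | succ i ih =>
    have hc := continuous_gaussKernel σ
    have hm : ∀ s, Measurable (gaussKernel σ s) := fun s => (hc s).measurable
    have hsum : 0 ≤ ∑ j : Fin i, a j.succ := Finset.sum_nonneg fun j _ => (ha _).le
    rw [← (volume_preserving_piFinSuccAbove (fun _ => ℝ) (0 : Fin (i + 1))).symm.lintegral_comp
      (by fun_prop), Measure.volume_eq_prod, lintegral_prod _ (by fun_prop)]
    simp only [MeasurableEquiv.piFinSuccAbove_symm_apply, Fin.insertNthEquiv, Equiv.coe_fn_mk,
      Fin.insertNth_zero, Fin.prod_univ_succ, Fin.sum_univ_succ, Fin.cons_zero, Fin.cons_succ,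
      cast_eq, mul_assoc, ← sub_sub]
    simp_rw [lintegral_const_mul' _ _ ENNReal.ofReal_ne_top,
      ih (fun j => a j.succ) (fun j => ha _)]
    rw [lintegral_gaussKernel_conv hσ (ha 0) (by positivity), add_assoc]

/-- The joint density of the increments, except the last one, of a Brownian bridge from `0` to `0`
with volatility `σ` over consecutive time intervals of lengths `a 0, …, a i`. -/
noncomputable def bridgeDensity (σ : ℝ) {i : ℕ} (a : Fin (i + 1) → ℝ) (w : Fin i → ℝ) : ℝ :=
  (∏ j : Fin i, gaussKernel σ (a j.castSucc) (w j)) *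
    gaussKernel σ (a (Fin.last i)) (-∑ j, w j) / gaussKernel σ (∑ j, a j) 0

lemma measurable_bridgeDensity (σ : ℝ) {i : ℕ} (a : Fin (i + 1) → ℝ) :
    Measurable (bridgeDensity σ a) := by
  have hm : ∀ s, Measurable (gaussKernel σ s) := fun s => (continuous_gaussKernel σ s).measurable
  unfold bridgeDensity
  fun_prop

/-- The joint law of the increments, except the last one, of a Brownian bridge. -/
noncomputable def bridgeMeasure (σ : ℝ) {i : ℕ} (a : Fin (i + 1) → ℝ) : Measure (Fin i → ℝ) :=
  volume.withDensity fun w => ENNReal.ofReal (bridgeDensity σ a w)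

section Bridge

variable {σ : ℝ} {i : ℕ} {a : Fin (i + 1) → ℝ}

lemma bridgeDensity_nonneg (hσ : 0 < σ) (ha : ∀ j, 0 < a j) (w : Fin i → ℝ) :
    0 ≤ bridgeDensity σ a w :=
  div_nonneg (mul_nonneg (Finset.prod_nonneg fun _ _ => (gaussKernel_pos hσ (ha _) _).le)
    (gaussKernel_pos hσ (ha _) _).le)
    (gaussKernel_pos hσ (Finset.sum_pos (fun j _ => ha j) Finset.univ_nonempty) _).le

lemma isProbabilityMeasure_bridgeMeasure (hσ : 0 < σ) (ha : ∀ j, 0 < a j) :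
    IsProbabilityMeasure (bridgeMeasure σ a) := by
  have hK := gaussKernel_pos hσ (Finset.sum_pos (fun j _ => ha j) Finset.univ_nonempty) 0
  constructor
  rw [bridgeMeasure, withDensity_apply _ MeasurableSet.univ, Measure.restrict_univ]
  have h := lintegral_prod_gaussKernel hσ (fun j : Fin i => a j.castSucc) (fun j => ha _)
    (ha (Fin.last i)) 0
  rw [← Fin.sum_univ_castSucc] at h
  have hw : ∀ w : Fin i → ℝ, ENNReal.ofReal (bridgeDensity σ a w) =
      (∏ j : Fin i, ENNReal.ofReal (gaussKernel σ (a j.castSucc) (w j))) *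
        ENNReal.ofReal (gaussKernel σ (a (Fin.last i)) (0 - ∑ j, w j)) *
        (ENNReal.ofReal (gaussKernel σ (∑ j, a j) 0))⁻¹ := fun w => by
    rw [bridgeDensity, ENNReal.ofReal_div_of_pos hK, ENNReal.ofReal_mul
      (Finset.prod_nonneg fun j _ => (gaussKernel_pos hσ (ha _) _).le),
      ENNReal.ofReal_prod_of_nonneg fun j _ => (gaussKernel_pos hσ (ha _) _).le, zero_sub,
      div_eq_mul_inv]
  have hne : ENNReal.ofReal (gaussKernel σ (∑ j, a j) 0) ≠ 0 := by simpa using hK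
  simp_rw [hw]
  rw [lintegral_mul_const' _ _ (ENNReal.inv_ne_top.2 hne), h,
    ENNReal.mul_inv_cancel hne ENNReal.ofReal_ne_top]

lemma integral_bridgeMeasure (hσ : 0 < σ) (ha : ∀ j, 0 < a j) (f : (Fin i → ℝ) → ℝ) :
    ∫ w, f w ∂bridgeMeasure σ a = ∫ w, bridgeDensity σ a w * f w := by
  rw [bridgeMeasure, integral_withDensity_eq_integral_toReal_smul
    (measurable_bridgeDensity σ a).ennreal_ofReal (by simp)]
  simp only [ENNReal.toReal_ofReal (bridgeDensity_nonneg hσ ha _), smul_eq_mul]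

lemma nullSingletonClass_map_bridgeMeasure {L : (Fin i → ℝ) →ₗ[ℝ] ℝ} (hL : L ≠ 0) :
    NullSingletonClass ((bridgeMeasure σ a).map L) := by
  have hLm : Measurable L := L.continuous_of_finiteDimensional.measurable
  constructor
  intro t
  obtain ⟨c, -, hc⟩ := L.exists_map_addHaar_eq_smul_addHaar volume volume
    (LinearMap.surjective hL)
  rw [Measure.map_apply hLm (measurableSet_singleton t)]
  refine withDensity_absolutelyContinuous _ _ ?_
  rw [← Measure.map_apply hLm (measurableSet_singleton t), hc]
  simp

/-- Tilting by a drift does not change the Gaussian bridge. -/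
lemma prod_gaussKernel_shift_div (hσ : 0 < σ) (ha : ∀ j, 0 < a j) (t : ℝ) (w : Fin i → ℝ) :
    (∏ j : Fin i, gaussKernel σ (a j.castSucc) (a j.castSucc * t + w j)) *
        gaussKernel σ (a (Fin.last i)) (a (Fin.last i) * t + -∑ j, w j) /
        gaussKernel σ (∑ j, a j) ((∑ j, a j) * t) = bridgeDensity σ a w := by
  have hK : 0 < ∑ j, a j := Finset.sum_pos (fun j _ => ha j) Finset.univ_nonempty
  have hsK := gaussKernel_shift hσ hK t 0
  rw [add_zero] at hsK
  simp_rw [gaussKernel_shift hσ (ha _), hsK]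
  rw [Finset.prod_mul_distrib, ← Real.exp_sum, mul_mul_mul_comm, ← Real.exp_add, bridgeDensity,
    mul_div_mul_comm]
  have h : ∑ j : Fin i, -(a j.castSucc * t ^ 2 + 2 * t * w j) / (2 * σ ^ 2) +
      -(a (Fin.last i) * t ^ 2 + 2 * t * -∑ j, w j) / (2 * σ ^ 2) =
      -((∑ j, a j) * t ^ 2 + 2 * t * 0) / (2 * σ ^ 2) := by
    rw [← Finset.sum_div, Finset.sum_neg_distrib, Finset.sum_add_distrib, ← Finset.sum_mul,
      ← Finset.mul_sum, Fin.sum_univ_castSucc]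
    ring
  rw [h, div_self (Real.exp_ne_zero _), mul_one]

/-- The normal transform is an expectation over a Gaussian bridge. -/
lemma normalTransform_eq_integral_bridgeMeasure (hσ : 0 < σ) (ha : ∀ j, 0 < a j) {n : ℝ}
    (hn : 0 < n) (μ x : ℝ) (b : Fin i → ℝ → ℝ) :
    normalTransform μ σ b (fun j => n * a j) x =
      ∫ w, ∏ j : Fin i, b j ((∑ l ∈ Finset.Iic j, a l.castSucc) / (∑ l, a l) * x +
        Real.sqrt n * ∑ l ∈ Finset.Iic j, w l) ∂bridgeMeasure σ a := by
  have hK : 0 < ∑ j, a j := Finset.sum_pos (fun j _ => ha j) Finset.univ_nonempty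
  set K := ∑ j, a j with hKdef
  have hn' : 0 < √n := by positivity
  set c : Fin i → ℝ := fun j => a j.castSucc / K * x with hc
  set t : ℝ := (x / K - μ * n) / √n with ht
  have hcsum : ∑ j, c j = x - a (Fin.last i) / K * x := by
    simp only [hc]
    rw [← Finset.sum_mul, ← Finset.sum_div]
    have := Fin.sum_univ_castSucc a
    rw [← hKdef] at this
    field_simp
    rw [this]
    ring
  have harg : ∀ s w : ℝ, s / K * x + √n * w - μ * (n * s) = √n * (s * t + w) := fun s w => by
    rw [ht]
    field_simp
    ring
  rw [integral_bridgeMeasure hσ ha]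
  unfold normalTransform
  rw [← Finset.mul_sum, ← hKdef, ← integral_div]
  have hx : (1 / (σ * √(n * K))) * stdNormalPDF ((x - μ * (n * K)) / (σ * √(n * K))) =
      gaussKernel σ K (K * t) / √n := by
    rw [← gaussKernel_scale hn, ← add_zero (K * t), ← harg, gaussKernel,
      div_self hK.ne', one_div_mul_eq_div]
    simp
  rw [hx]
  simp_rw [Finset.prod_mul_distrib]
  change ∫ z : Fin i → ℝ, ((∏ j, gaussKernel σ (n * a j.castSucc) (z j - μ * (n * a j.castSucc))) *
    (∏ j, b j (∑ l ∈ Finset.Iic j, z l))) * gaussKernel σ (n * a (Fin.last i))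
      (x - ∑ l, z l - μ * (n * a (Fin.last i))) / (gaussKernel σ K (K * t) / √n) = _
  rw [← integral_add_right_eq_self _ c]
  have hs := fun F : (Fin i → ℝ) → ℝ => Measure.integral_comp_smul_of_nonneg volume F √n
    (hR := hn'.le)
  simp only [Module.finrank_fin_fun, smul_eq_mul] at hs
  rw [← mul_right_inj' (a := ((√n) ^ i)⁻¹) (by positivity), ← hs, ← integral_const_mul]
  refine integral_congr_ae (Filter.Eventually.of_forall fun w => ?_)
  simp only [Pi.add_apply, Pi.smul_apply, smul_eq_mul, Finset.sum_add_distrib, ← Finset.mul_sum]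
  have h1 : ∀ j, √n * w j + c j - μ * (n * a j.castSucc) =
      √n * (a j.castSucc * t + w j) := fun j => by
    rw [← harg, add_comm (√n * w j)]
  have h2 : x - (√n * ∑ l, w l + ∑ l, c l) - μ * (n * a (Fin.last i)) =
      √n * (a (Fin.last i) * t + -∑ j, w j) := by
    rw [← harg, hcsum]
    ring
  have h3 : ∀ j, √n * ∑ l ∈ Finset.Iic j, w l + ∑ l ∈ Finset.Iic j, c l =
      (∑ l ∈ Finset.Iic j, a l.castSucc) / K * x + √n * ∑ l ∈ Finset.Iic j, w l := fun j => by
    rw [add_comm, ← Finset.sum_mul, ← Finset.sum_div]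
  simp_rw [h1, h2, h3, gaussKernel_scale hn]
  rw [← prod_gaussKernel_shift_div hσ ha t w, Finset.prod_div_distrib, Finset.prod_const,
    Finset.card_univ, Fintype.card_fin, ← hKdef]
  generalize ∏ j : Fin i, gaussKernel σ (a j.castSucc) (a j.castSucc * t + w j) = A
  generalize ∏ j : Fin i, b j _ = B
  generalize gaussKernel σ (a (Fin.last i)) _ = C
  generalize gaussKernel σ K (K * t) = G
  field_simp

end Bridge

/-- For `i = m + 2` with `2 ≤ i ≤ L`, there exist random variables
`σ_{i,1}, …, σ_{i,i−1}` with atomless (continuous) laws, depending only on `γ`, `σ` and the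
`k_j`, such that for all `μ`, all Borel measurable `ψ : ℝ → [0,1]`, all `n ≥ 1` and all `x`,
`𝒩_{n,i}(x) = E[ ∏_{j=1}^{i−1} (1−ψ)( (k_j^{1−γ}/k_i)·n^{−γ}·x + σ_{i,j}·n^{1/2−γ} ) ]`,
where `𝒩_{n,i}(x) = 𝒩_{(1−ψ_{m_{n,1}},…,1−ψ_{m_{n,i−1}}),μ,σ}(Δ_{m_{n,1}},…,Δ_{m_{n,i}},x)`
with `m_{n,j} = k_j n`, `ψ_m(y) = ψ(y/m^γ)`, `Δ_{m_{n,1}} = m_{n,1}` and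
`Δ_{m_{n,j}} = m_{n,j} − m_{n,j−1}`. -/
theorem normalTransform_Nni_representation
    (σ γ : ℝ) (hσ : 0 < σ) (hγ : 0 ≤ γ)
    (L : ℕ) (hL : 2 ≤ L)
    (k : ℕ → ℕ) (hk1 : 0 < k 1) (hkmono : ∀ i, 1 ≤ i → i ≤ L → k i < k (i + 1))
    (m : ℕ) (him : m + 2 ≤ L) :
    ∃ (Ω : Type) (_ : MeasurableSpace Ω) (P : Measure Ω) (_ : IsProbabilityMeasure P)
      (σs : Fin (m + 1) → Ω → ℝ),
      (∀ j, Measurable (σs j)) ∧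
      (∀ j, NoAtoms (P.map (σs j))) ∧
      (∀ (μ : ℝ) (ψ : ℝ → ℝ), Measurable ψ → (∀ y, ψ y ∈ Set.Icc (0 : ℝ) 1) →
        ∀ (n : ℕ), 1 ≤ n → ∀ x : ℝ,
          normalTransform μ σ
            (fun j : Fin (m + 1) => fun y =>
              1 - ψ (y / ((k (j.val + 1) * n : ℕ) : ℝ) ^ γ))
            (fun j : Fin (m + 2) =>
              if j.val = 0 then ((k 1 * n : ℕ) : ℝ)
              else ((k (j.val + 1) * n : ℕ) : ℝ) - ((k j.val * n : ℕ) : ℝ))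
            x =
          ∫ ω, ∏ j : Fin (m + 1),
              (1 - ψ ((k (j.val + 1) : ℝ) ^ (1 - γ) / (k (m + 2) : ℝ) * (n : ℝ) ^ (-γ) * x +
                σs j ω * (n : ℝ) ^ ((1 : ℝ) / 2 - γ))) ∂P) := by
  set a : Fin (m + 2) → ℝ := fun j =>
    if j.val = 0 then (k 1 : ℝ) else (k (j.val + 1) : ℝ) - (k j.val : ℝ) with ha_def
  have ha : ∀ j, 0 < a j := fun j => by
    simp only [ha_def]
    split_ifs with h
    · exact_mod_cast hk1
    · rw [sub_pos]
      exact_mod_cast hkmono j.val (by omega) (by omega)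
  have hkpos : ∀ j, j ≤ m + 1 → 0 < k (j + 1) := fun j hj => by
    rcases Nat.eq_zero_or_pos j with rfl | h
    · exact hk1
    · exact (Nat.zero_le _).trans_lt (hkmono j h (by omega))
  have hrange : ∀ N, ∑ l ∈ Finset.range (N + 1),
      (if l = 0 then (k 1 : ℝ) else (k (l + 1) : ℝ) - (k l : ℝ)) = k (N + 1) := fun N => by
    induction N with
    | zero => simp
    | succ N ih => rw [Finset.sum_range_succ, ih]; simp
  have hK : ∑ j, a j = k (m + 2) := by
    rw [← hrange (m + 1), ← Fin.sum_univ_eq_sum_range]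
  have hpart : ∀ j : Fin (m + 1), ∑ l ∈ Finset.Iic j, a l.castSucc = k (j.val + 1) := fun j => by
    rw [← hrange j.val, Nat.range_succ_eq_Iic, ← Fin.map_valEmbedding_Iic, Finset.sum_map]
    rfl
  have hscale : ∀ j : Fin (m + 1), (k (j.val + 1) : ℝ) ^ (-γ) ≠ 0 := fun j =>
    (Real.rpow_pos_of_pos (by exact_mod_cast hkpos j.val (by omega)) _).ne'
  let ℓ : Fin (m + 1) → (Fin (m + 1) → ℝ) →ₗ[ℝ] ℝ := fun j =>
    (k (j.val + 1) : ℝ) ^ (-γ) • ∑ l ∈ Finset.Iic j, LinearMap.proj l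
  have hℓ : ∀ j w, ℓ j w = (k (j.val + 1) : ℝ) ^ (-γ) * ∑ l ∈ Finset.Iic j, w l := fun j w => by
    simp [ℓ]
  refine ⟨Fin (m + 1) → ℝ, inferInstance, bridgeMeasure σ a,
    isProbabilityMeasure_bridgeMeasure hσ ha, fun j => ℓ j,
    fun j => (ℓ j).continuous_of_finiteDimensional.measurable,
    fun j => nullSingletonClass_map_bridgeMeasure fun h => ?_, fun μ ψ _ _ n hn x => ?_⟩
  · have h1 := hℓ j (Pi.single j 1)
    rw [h] at h1
    rw [LinearMap.zero_apply, Finset.sum_pi_single', if_pos (Finset.mem_Iic.2 le_rfl), mul_one] at h1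
    exact hscale j h1.symm
  · have hn0 : (0 : ℝ) < n := by exact_mod_cast hn
    have hxs : (fun j : Fin (m + 2) =>
        if j.val = 0 then ((k 1 * n : ℕ) : ℝ)
        else ((k (j.val + 1) * n : ℕ) : ℝ) - ((k j.val * n : ℕ) : ℝ)) = fun j => n * a j := by
      funext j
      simp only [ha_def]
      split_ifs <;> push_cast <;> ring
    rw [hxs, normalTransform_eq_integral_bridgeMeasure hσ ha hn0, hK]
    refine integral_congr_ae (Filter.Eventually.of_forall fun w => ?_)
    refine Finset.prod_congr rfl fun j _ => ?_
    have hkj : (0 : ℝ) < k (j.val + 1) := by exact_mod_cast hkpos j.val (by omega)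
    simp only [hℓ, hpart]
    congr 2
    push_cast
    rw [Real.mul_rpow hkj.le hn0.le, Real.rpow_sub hkj, Real.rpow_one, Real.rpow_neg hkj.le,
      Real.rpow_neg hn0.le, Real.rpow_sub hn0, ← Real.sqrt_eq_rpow]
    have := Real.rpow_pos_of_pos hkj γ
    have := Real.rpow_pos_of_pos hn0 γ
    field_simp
end

section
/- Let ξ and η be independent standard normally distributed random variables, let C > 0, and let x ∈ ℝ. Then E[ 1_{(−∞,x]}(ξ) · 1_{(−C,C)}( (√2/2)(ξ + η) ) ] = E[ Φ( (√2·C − η) ∧ x ) − Φ( (−√2·C − η) ∧ x ) ], where ∧ denotes the minimum of two numbers and Φ is the standard normal cdf. -/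
open MeasureTheory ProbabilityTheory Real

/-- The standard normal cumulative distribution function `Φ`. -/
noncomputable def stdNormalCDF (x : ℝ) : ℝ := ((gaussianReal 0 1) (Set.Iic x)).toReal

theorem measureReal_Iic_inter_Ioo_eq_stdNormalCDF_sub {a b : ℝ} (hab : a ≤ b) (x : ℝ) :
    (gaussianReal 0 1).real (Set.Iic x ∩ Set.Ioo a b) =
      stdNormalCDF (min b x) - stdNormalCDF (min a x) := by
  have : NullSingletonClass (gaussianReal 0 1) := nullSingletonClass_gaussianReal one_ne_zero
  have hset : Set.Iic x ∩ Set.Ioc a b = Set.Iic (min b x) \ Set.Iic (min a x) := by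
    ext u
    simp only [Set.mem_inter_iff, Set.mem_Iic, Set.mem_Ioc, Set.mem_sdiff, le_min_iff]
    grind
  have hae : (Set.Iic x ∩ Set.Ioo a b : Set ℝ) =ᵐ[gaussianReal 0 1]
      (Set.Iic x ∩ Set.Ioc a b : Set ℝ) :=
    Filter.EventuallyEq.rfl.inter Ioo_ae_eq_Ioc
  rw [measureReal_congr hae, hset, measureReal_sdiff
    (Set.Iic_subset_Iic.2 (min_le_min_right x hab)) measurableSet_Iic]
  rfl

theorem indicator_Iic_mul_indicator_Ioo_eq (C x u v : ℝ) :
    (Set.Iic x).indicator (fun _ => (1 : ℝ)) u *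
        (Set.Ioo (-C) C).indicator (fun _ => (1 : ℝ)) (√2 / 2 * (u + v)) =
      (Set.Iic x ∩ Set.Ioo (-(√2 * C) - v) (√2 * C - v)).indicator (fun _ => (1 : ℝ)) u := by
  have hpos : 0 < √2 := by positivity
  have hsq : √2 * √2 = 2 := Real.mul_self_sqrt zero_le_two
  have hmul : √2 * (√2 / 2 * (u + v)) = u + v := by linear_combination (u + v) / 2 * hsq
  have hiff : √2 / 2 * (u + v) ∈ Set.Ioo (-C) C ↔
      u ∈ Set.Ioo (-(√2 * C) - v) (√2 * C - v) := by
    rw [Set.mem_Ioo, Set.mem_Ioo, ← mul_lt_mul_iff_right₀ hpos,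
      ← mul_lt_mul_iff_right₀ hpos (c := C), hmul]
    constructor <;> rintro ⟨h₁, h₂⟩ <;> constructor <;> linarith
  by_cases hu : u ≤ x <;>
    by_cases hv : u ∈ Set.Ioo (-(√2 * C) - v) (√2 * C - v) <;>
    simp only [Set.indicator_apply, Set.mem_inter_iff, Set.mem_Iic, hiff, hu, hv] <;> simp

/-- For independent standard normally distributed `ξ` and `η`, `C > 0` and `x ∈ ℝ`,
`E[1_{(−∞,x]}(ξ)·1_{(−C,C)}((√2/2)(ξ+η))]
  = E[Φ((√2·C − η) ∧ x) − Φ((−√2·C − η) ∧ x)]`. -/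
theorem indicator_expectation_eq
    {Ω : Type*} [MeasurableSpace Ω] (P : Measure Ω) [IsProbabilityMeasure P]
    (ξ η : Ω → ℝ) (hξmeas : Measurable ξ) (hηmeas : Measurable η)
    (hξlaw : P.map ξ = gaussianReal 0 1) (hηlaw : P.map η = gaussianReal 0 1)
    (hindep : IndepFun ξ η P)
    (C : ℝ) (hC : 0 < C) (x : ℝ) :
    ∫ ω, (Set.Iic x).indicator (fun _ => (1 : ℝ)) (ξ ω) *
        (Set.Ioo (-C) C).indicator (fun _ => (1 : ℝ))
          (Real.sqrt 2 / 2 * (ξ ω + η ω)) ∂P =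
      ∫ ω, (stdNormalCDF (min (Real.sqrt 2 * C - η ω) x) -
        stdNormalCDF (min (-(Real.sqrt 2 * C) - η ω) x)) ∂P := by
  have hpos : 0 < √2 * C := by positivity
  set f : ℝ × ℝ → ℝ := fun p => (Set.Iic x).indicator (fun _ => (1 : ℝ)) p.2 *
    (Set.Ioo (-C) C).indicator (fun _ => (1 : ℝ)) (√2 / 2 * (p.2 + p.1)) with hf
  have hfmeas : Measurable f :=
    ((measurable_const.indicator measurableSet_Iic).comp measurable_snd).mul
      ((measurable_const.indicator measurableSet_Ioo).comp (by fun_prop))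
  have hfint : Integrable f ((gaussianReal 0 1).prod (gaussianReal 0 1)) := by
    refine Integrable.of_bound hfmeas.aestronglyMeasurable 1 (ae_of_all _ fun p => ?_)
    simp only [hf, indicator_Iic_mul_indicator_Ioo_eq]
    exact (norm_indicator_le_norm_self _ _).trans (by simp)
  have hsection (v : ℝ) : ∫ u, f (v, u) ∂gaussianReal 0 1 =
      stdNormalCDF (min (√2 * C - v) x) - stdNormalCDF (min (-(√2 * C) - v) x) := by
    simp only [hf, indicator_Iic_mul_indicator_Ioo_eq]
    rw [integral_indicator_const _ (measurableSet_Iic.inter measurableSet_Ioo), smul_eq_mul,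
      mul_one, measureReal_Iic_inter_Ioo_eq_stdNormalCDF_sub (by linarith)]
  have hlaw : P.map (fun ω => (η ω, ξ ω)) = (gaussianReal 0 1).prod (gaussianReal 0 1) := by
    rw [hindep.symm.map_prod_eq_prod_map_map hηmeas.aemeasurable hξmeas.aemeasurable,
      hξlaw, hηlaw]
  have hsm : AEStronglyMeasurable (fun v => ∫ u, f (v, u) ∂gaussianReal 0 1) (P.map η) :=
    hηlaw ▸ hfint.integral_prod_left.aestronglyMeasurable
  calc _ = ∫ p, f p ∂P.map (fun ω => (η ω, ξ ω)) :=
        (integral_map (hηmeas.prodMk hξmeas).aemeasurable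
          hfmeas.aestronglyMeasurable).symm
    _ = ∫ v, ∫ u, f (v, u) ∂gaussianReal 0 1 ∂P.map η := by
        rw [hlaw, integral_prod _ hfint, hηlaw]
    _ = _ := by
        rw [integral_map hηmeas.aemeasurable hsm]
        simp only [hsection]
end
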